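/- arXiv:2104.09816 — 2 statements merged into one kernel-verified Lean document; each statement's English description precedes it below -/
import Mathlib

section
/- If two pointed relational models (M1,w1) and (M2,w2) are generalized sabotage bisimilar (g-bisimilar), then they satisfy exactly the same formulas of generalized sabotage modal logic GSML: for every GSML formula φ, (M1,w1) ⊨ φ if and only if (M2,w2) ⊨ φ. -/
/-- A relational model: a relation on worlds `α` and a valuation of
propositional letters `P`. -/
structure Model (α P : Type*) where
  rel : Set (α × α)
  val : P → Set α

variable {α β P : Type*}

/-- The model obtained from `M` by deleting the edge `e`. -/
def Model.delEdge (M : Model α P) (e : α × α) : Model α P :=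
  ⟨M.rel \ {e}, M.val⟩

/-- Formulas of generalized sabotage modal logic (GSML):
`φ ::= p | ¬φ | φ∧φ | ◇φ | ◆^ψ_χ φ`. -/
inductive GForm (P : Type*) where
  | atom : P → GForm P
  | neg : GForm P → GForm P
  | and : GForm P → GForm P → GForm P
  | dia : GForm P → GForm P
  | gsab : GForm P → GForm P → GForm P → GForm P

/-- Truth of a GSML formula at a pointed model.  In particular
`(M,w) ⊨ ◆^ψ_χ φ` iff there is an edge `(u,v) ∈ R` with `(M,u) ⊨ ψ`,
`(M,v) ⊨ χ` and `(M with (u,v) deleted, w) ⊨ φ`. -/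
def Model.Sat : Model α P → α → GForm P → Prop
  | M, w, .atom p => w ∈ M.val p
  | M, w, .neg φ => ¬ M.Sat w φ
  | M, w, .and φ ψ => M.Sat w φ ∧ M.Sat w ψ
  | M, w, .dia φ => ∃ v, (w, v) ∈ M.rel ∧ M.Sat v φ
  | M, w, .gsab ψ χ φ =>
      ∃ e ∈ M.rel, M.Sat e.1 ψ ∧ M.Sat e.2 χ ∧ (M.delEdge e).Sat w φ

/-- `Z` is a generalized sabotage bisimulation between pointed models. -/
def IsGBisim (Z : Model α P → α → Model β P → β → Prop) : Prop :=
  ∀ M1 w1 M2 w2, Z M1 w1 M2 w2 →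
    (∀ p, w1 ∈ M1.val p ↔ w2 ∈ M2.val p) ∧
    (∀ v1, (w1, v1) ∈ M1.rel → ∃ v2, (w2, v2) ∈ M2.rel ∧ Z M1 v1 M2 v2) ∧
    (∀ v2, (w2, v2) ∈ M2.rel → ∃ v1, (w1, v1) ∈ M1.rel ∧ Z M1 v1 M2 v2) ∧
    (∀ e1 ∈ M1.rel, ∃ e2 ∈ M2.rel,
      Z M1 e1.1 M2 e2.1 ∧ Z M1 e1.2 M2 e2.2 ∧
        Z (M1.delEdge e1) w1 (M2.delEdge e2) w2) ∧
    (∀ e2 ∈ M2.rel, ∃ e1 ∈ M1.rel,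
      Z M1 e1.1 M2 e2.1 ∧ Z M1 e1.2 M2 e2.2 ∧
        Z (M1.delEdge e1) w1 (M2.delEdge e2) w2)

/-- Two pointed models are generalized sabotage bisimilar (g-bisimilar). -/
def GBisimilar (M1 : Model α P) (w1 : α) (M2 : Model β P) (w2 : β) : Prop :=
  ∃ Z, IsGBisim Z ∧ Z M1 w1 M2 w2

/-- Related pointed models of a generalized sabotage bisimulation satisfy the same formulas. -/
theorem IsGBisim.sat_iff {Z : Model α P → α → Model β P → β → Prop} (hZ : IsGBisim Z)
    (φ : GForm P) {M1 : Model α P} {w1 : α} {M2 : Model β P} {w2 : β}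
    (h : Z M1 w1 M2 w2) : M1.Sat w1 φ ↔ M2.Sat w2 φ := by
  induction φ generalizing M1 w1 M2 w2 with
  | atom p => exact (hZ _ _ _ _ h).1 p
  | neg φ ih => exact not_congr (ih h)
  | and φ ψ ihφ ihψ => exact and_congr (ihφ h) (ihψ h)
  | dia φ ih =>
    obtain ⟨-, zig, zag, -, -⟩ := hZ _ _ _ _ h
    constructor
    · rintro ⟨v1, hv, hφ⟩
      obtain ⟨v2, hv2, hz⟩ := zig v1 hv
      exact ⟨v2, hv2, (ih hz).1 hφ⟩
    · rintro ⟨v2, hv, hφ⟩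
      obtain ⟨v1, hv1, hz⟩ := zag v2 hv
      exact ⟨v1, hv1, (ih hz).2 hφ⟩
  | gsab ψ χ φ ihψ ihχ ihφ =>
    obtain ⟨-, -, -, zig, zag⟩ := hZ _ _ _ _ h
    constructor
    · rintro ⟨e1, he, hψ, hχ, hφ⟩
      obtain ⟨e2, he2, hs, ht, hd⟩ := zig e1 he
      exact ⟨e2, he2, (ihψ hs).1 hψ, (ihχ ht).1 hχ, (ihφ hd).1 hφ⟩
    · rintro ⟨e2, he, hψ, hχ, hφ⟩
      obtain ⟨e1, he1, hs, ht, hd⟩ := zag e2 he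
      exact ⟨e1, he1, (ihψ hs).2 hψ, (ihχ ht).2 hχ, (ihφ hd).2 hφ⟩

/-- If two pointed models are generalized sabotage bisimilar, then they satisfy
the same GSML formulas. -/
theorem gbisimilar_iff_sat (M1 : Model α P) (w1 : α) (M2 : Model β P) (w2 : β)
    (h : GBisimilar M1 w1 M2 w2) :
    ∀ φ : GForm P, M1.Sat w1 φ ↔ M2.Sat w2 φ := by
  obtain ⟨Z, hZ, hz⟩ := h
  exact fun φ => hZ.sat_iff φ hz
end

section
/- Suppose M has n edges and (N',t) is an expansion of (N,t) satisfying G(M) with p_s true at t. Then for any sequence (j1,…,jl) of pairwise distinct edges of N with 0 ≤ l ≤ n, if there is a path t0 → t1 → ⋯ → tk in N_(j1,…,jl) with t0 reachable from t in N, then there exist a sequence (d1,…,dl) of pairwise distinct edges of M and a path s0 → s1 → ⋯ → sk in M_(d1,…,dl) with s0 reachable from s in M, such that for each i ∈ [0,k] and each original propositional letter p, s_i ∈ V1(p) iff t_i ∈ V2(p). -/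
/-! Infrastructure for sabotage modal logic over finite models. -/

/-- A finite relational model: a finite relation on worlds `α` and a valuation
of propositional letters `P`. -/
structure FinModel (α P : Type*) where
  rel : Finset (α × α)
  val : P → Finset α

variable {α β P : Type*}

/-- The model obtained from `M` by deleting the edge `e`. -/
def FinModel.delEdge [DecidableEq α] (M : FinModel α P) (e : α × α) :
    FinModel α P :=
  ⟨M.rel.erase e, M.val⟩

/-- The model obtained from `M` by deleting the edges in `d` (in order). -/
def FinModel.delEdges [DecidableEq α] (M : FinModel α P) (d : List (α × α)) :
    FinModel α P :=
  d.foldl FinModel.delEdge M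

/-- Formulas of sabotage modal logic (SML), with verum:
`φ ::= ⊤ | p | ¬φ | φ∧φ | ◇φ | ◆φ`. -/
inductive SForm (Q : Type*) where
  | top : SForm Q
  | atom : Q → SForm Q
  | neg : SForm Q → SForm Q
  | and : SForm Q → SForm Q → SForm Q
  | dia : SForm Q → SForm Q
  | sab : SForm Q → SForm Q

namespace SForm

variable {Q : Type*}

/-- Falsum. -/
def bot : SForm Q := .neg .top

/-- Disjunction, defined from `¬` and `∧`. -/
def or (φ ψ : SForm Q) : SForm Q := .neg (.and (.neg φ) (.neg ψ))

/-- Implication, defined from `¬` and `∧`. -/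
def imp (φ ψ : SForm Q) : SForm Q := .neg (.and φ (.neg ψ))

/-- `□`, the dual of `◇`. -/
def box (φ : SForm Q) : SForm Q := .neg (.dia (.neg φ))

/-- `■`, the dual of `◆`. -/
def boxSab (φ : SForm Q) : SForm Q := .neg (.sab (.neg φ))

/-- Finite conjunction. -/
def bigAnd (l : List (SForm Q)) : SForm Q := l.foldr .and .top

/-- Finite disjunction. -/
def bigOr (l : List (SForm Q)) : SForm Q := l.foldr or bot

end SForm

/-- Truth of an SML formula at a pointed model.  In particular
`(M,w) ⊨ ◆φ` iff there is an edge `e ∈ R` such that `φ` holds at `w` after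
deleting `e`. -/
def FinModel.Sat [DecidableEq α] : FinModel α P → α → SForm P → Prop
  | _, _, .top => True
  | M, w, .atom p => w ∈ M.val p
  | M, w, .neg φ => ¬ M.Sat w φ
  | M, w, .and φ ψ => M.Sat w φ ∧ M.Sat w ψ
  | M, w, .dia φ => ∃ v, (w, v) ∈ M.rel ∧ M.Sat v φ
  | M, w, .sab φ => ∃ e ∈ M.rel, (M.delEdge e).Sat w φ

section CharFormula

variable [Fintype α] [DecidableEq α] [Fintype P]

/-- `AT_x`: the conjunction of all literals over the original letters that are
true at `(M,x)`. -/
noncomputable def ATx (M : FinModel α P) (x : α) : SForm (P ⊕ α) :=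
  SForm.bigAnd ((Finset.univ : Finset P).toList.map fun p =>
    if x ∈ M.val p then .atom (.inl p) else .neg (.atom (.inl p)))

/-- The list of successors of `x` in `M`. -/
noncomputable def succList (M : FinModel α P) (x : α) : List α :=
  (Finset.univ.filter fun y => (x, y) ∈ M.rel).toList

/-- `env(M,x) = ⋀_{y : R x y} ◇p_y ∧ □ ⋁_{y : R x y} p_y`. -/
noncomputable def envF (M : FinModel α P) (x : α) : SForm (P ⊕ α) :=
  .and (SForm.bigAnd ((succList M x).map fun y => .dia (.atom (.inr y))))
    (SForm.box (SForm.bigOr ((succList M x).map fun y => .atom (.inr y))))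

/-- `E(M) = ⋀_x (p_x → AT_x ∧ env(M,x))`. -/
noncomputable def EF (M : FinModel α P) : SForm (P ⊕ α) :=
  SForm.bigAnd ((Finset.univ : Finset α).toList.map fun x =>
    SForm.imp (.atom (.inr x)) (.and (ATx M x) (envF M x)))

/-- All sequences of pairwise distinct elements of `es` of length `k`. -/
def distinctSeqs {E : Type*} [DecidableEq E] (es : List E) : ℕ → List (List E)
  | 0 => [[]]
  | k + 1 => es.flatMap fun e =>
      (distinctSeqs es k).filterMap fun d => if e ∈ d then none else some (e :: d)

/-- `G_k(M) = ⋀_{P_(i1,…,ik)} ◆^k E(M_(i1,…,ik)) ∧ ■^k ⋁_{P_(i1,…,ik)} E(M_(i1,…,ik))`. -/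
noncomputable def GkF (M : FinModel α P) (k : ℕ) : SForm (P ⊕ α) :=
  .and (SForm.bigAnd ((distinctSeqs M.rel.toList k).map fun d =>
      SForm.sab^[k] (EF (M.delEdges d))))
    (SForm.boxSab^[k] (SForm.bigOr ((distinctSeqs M.rel.toList k).map fun d =>
      EF (M.delEdges d))))

/-- `G(M) = E(M) ∧ ⋀_{1 ≤ i ≤ n} G_i(M) ∧ ¬◆^{n+1}⊤`, where `n` is the number
of edges of `M`. -/
noncomputable def GF (M : FinModel α P) : SForm (P ⊕ α) :=
  .and (EF M)
    (SForm.bigAnd (((List.range M.rel.card).map fun i => GkF M (i + 1)) ++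
      [.neg (SForm.sab^[M.rel.card + 1] .top)]))

end CharFormula

/-- The expansion of `N` interpreting each fresh letter `p_x` (for `x : α`)
as the set `f x`, keeping the relation and the original valuation unchanged. -/
def FinModel.expand (N : FinModel β P) (f : α → Finset β) :
    FinModel β (P ⊕ α) :=
  ⟨N.rel, fun q => Sum.elim N.val f q⟩

/-- A path `x0 → x1 → ⋯ → xk` in a model: consecutive points are related by
the model's relation. -/
def FinModel.IsPath [DecidableEq α] (M : FinModel α P) (xs : List α) : Prop :=
  xs.Chain' fun a b => (a, b) ∈ M.rel

/-- `y` is reachable from `x` in `M` by a (possibly empty) path. -/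
def FinModel.Reach [DecidableEq α] (M : FinModel α P) (x y : α) : Prop :=
  Relation.ReflTransGen (fun a b => (a, b) ∈ M.rel) x y

section Semantics

variable {Q : Type*} [DecidableEq β]

theorem FinModel.sat_bigAnd (N : FinModel β Q) (w : β) (l : List (SForm Q)) :
    N.Sat w (SForm.bigAnd l) ↔ ∀ φ ∈ l, N.Sat w φ := by
  induction l with
  | nil => simp [SForm.bigAnd, FinModel.Sat]
  | cons φ l ih =>
    change N.Sat w φ ∧ N.Sat w (SForm.bigAnd l) ↔ _
    rw [ih, List.forall_mem_cons]

theorem FinModel.sat_bigOr (N : FinModel β Q) (w : β) (l : List (SForm Q)) :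
    N.Sat w (SForm.bigOr l) ↔ ∃ φ ∈ l, N.Sat w φ := by
  induction l with
  | nil => simp [SForm.bigOr, SForm.bot, FinModel.Sat]
  | cons φ l ih =>
    change ¬ (¬ N.Sat w φ ∧ ¬ N.Sat w (SForm.bigOr l)) ↔ _
    rw [ih, List.exists_mem_cons_iff, or_iff_not_and_not]

theorem FinModel.sat_imp (N : FinModel β Q) (w : β) (φ ψ : SForm Q) :
    N.Sat w (SForm.imp φ ψ) ↔ (N.Sat w φ → N.Sat w ψ) := by
  change ¬ (N.Sat w φ ∧ ¬ N.Sat w ψ) ↔ _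
  tauto

theorem FinModel.sat_box (N : FinModel β Q) (w : β) (φ : SForm Q) :
    N.Sat w (SForm.box φ) ↔ ∀ v, (w, v) ∈ N.rel → N.Sat v φ := by
  change ¬ (∃ v, (w, v) ∈ N.rel ∧ ¬ N.Sat v φ) ↔ _
  push Not
  rfl

theorem FinModel.delEdges_val (N : FinModel β Q) (d : List (β × β)) :
    (N.delEdges d).val = N.val := by
  induction d generalizing N with
  | nil => rfl
  | cons e d ih => exact ih (N.delEdge e)

theorem FinModel.mem_delEdges_rel (N : FinModel β Q) (d : List (β × β)) (e : β × β) :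
    e ∈ (N.delEdges d).rel ↔ e ∈ N.rel ∧ e ∉ d := by
  induction d generalizing N with
  | nil => simp [FinModel.delEdges]
  | cons e' d ih =>
    change e ∈ ((N.delEdge e').delEdges d).rel ↔ _
    rw [ih]
    simp [FinModel.delEdge]
    tauto

theorem FinModel.exists_delEdges_of_sat_sab_iterate {N : FinModel β Q} {w : β} {k : ℕ}
    {φ : SForm Q} (h : N.Sat w (SForm.sab^[k] φ)) :
    ∃ d : List (β × β), (N.delEdges d).Sat w φ := by
  induction k generalizing N with
  | zero => exact ⟨[], h⟩
  | succ k ih =>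
    rw [Function.iterate_succ_apply'] at h
    obtain ⟨e, -, he⟩ := h
    obtain ⟨d, hd⟩ := ih he
    exact ⟨e :: d, hd⟩

theorem FinModel.sat_sab_iterate_top (N : FinModel β Q) (w : β) {k : ℕ}
    (hk : k ≤ N.rel.card) : N.Sat w (SForm.sab^[k] .top) := by
  induction k generalizing N with
  | zero => exact trivial
  | succ k ih =>
    rw [Function.iterate_succ_apply']
    obtain ⟨e, he⟩ := Finset.card_pos.mp (Nat.zero_lt_of_lt hk)
    refine ⟨e, he, ih _ ?_⟩
    change k ≤ (N.rel.erase e).card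
    rw [Finset.card_erase_of_mem he]
    omega

end Semantics

theorem mem_distinctSeqs {E : Type*} [DecidableEq E] {es d : List E} (hnd : d.Nodup)
    (hsub : ∀ e ∈ d, e ∈ es) : d ∈ distinctSeqs es d.length := by
  induction d with
  | nil => simp [distinctSeqs]
  | cons e d ih =>
    rw [List.nodup_cons] at hnd
    rw [List.forall_mem_cons] at hsub
    simp only [List.length_cons, distinctSeqs, List.mem_flatMap, List.mem_filterMap]
    exact ⟨e, hsub.1, d, ih hnd.2 hsub.2, by simp [hnd.1]⟩

section Labelling

variable [Fintype α] [DecidableEq α] [DecidableEq β] [Fintype P]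

theorem FinModel.Sat.of_EF {M : FinModel α P} {N : FinModel β (P ⊕ α)} {w : β}
    (h : N.Sat w (EF M)) {x : α} (hx : w ∈ N.val (.inr x)) :
    (∀ p, x ∈ M.val p ↔ w ∈ N.val (.inl p)) ∧
      (∀ y, (x, y) ∈ M.rel → ∃ v, (w, v) ∈ N.rel ∧ v ∈ N.val (.inr y)) ∧
      ∀ v, (w, v) ∈ N.rel → ∃ y, (x, y) ∈ M.rel ∧ v ∈ N.val (.inr y) := by
  rw [EF, FinModel.sat_bigAnd] at h
  have hcl := h _ (List.mem_map.mpr ⟨x, by simp, rfl⟩)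
  rw [FinModel.sat_imp] at hcl
  obtain ⟨hat, hforth, hback⟩ := hcl hx
  rw [ATx, FinModel.sat_bigAnd] at hat
  rw [FinModel.sat_bigAnd] at hforth
  rw [FinModel.sat_box] at hback
  refine ⟨fun p => ?_, fun y hy => ?_, fun v hv => ?_⟩
  · have hp := hat _ (List.mem_map.mpr ⟨p, by simp, rfl⟩)
    split_ifs at hp with hxp
    · exact iff_of_true hxp hp
    · exact iff_of_false hxp hp
  · exact hforth _ (List.mem_map.mpr ⟨y, by simpa [succList] using hy, rfl⟩)
  · obtain ⟨φ, hφ, hsat⟩ := (FinModel.sat_bigOr _ _ _).mp (hback v hv)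
    obtain ⟨y, hy, rfl⟩ := List.mem_map.mp hφ
    exact ⟨y, by simpa [succList] using hy, hsat⟩

theorem FinModel.Sat.card_rel_le {M : FinModel α P} {N : FinModel β (P ⊕ α)} {w : β}
    (h : N.Sat w (GF M)) : N.rel.card ≤ M.rel.card := by
  by_contra! hlt
  refine (FinModel.sat_bigAnd _ _ _).mp h.2 _
    (List.mem_append_right _ (List.mem_singleton_self _)) ?_
  exact N.sat_sab_iterate_top w hlt

theorem FinModel.Sat.exists_delEdges_EF {M : FinModel α P} {N : FinModel β (P ⊕ α)} {w : β}
    (h : N.Sat w (GF M)) {d : Finset (α × α)} (hd : d ⊆ M.rel) (hne : d.Nonempty) :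
    ∃ d' : List (β × β), (N.delEdges d').Sat w (EF (M.delEdges d.toList)) := by
  have hpos := hne.card_pos
  have hle := Finset.card_le_card hd
  have hG := (FinModel.sat_bigAnd _ _ _).mp h.2 (GkF M d.card)
    (List.mem_append_left _ (List.mem_map.mpr
      ⟨d.card - 1, List.mem_range.mpr (by omega), by rw [Nat.sub_add_cancel hpos]⟩))
  refine FinModel.exists_delEdges_of_sat_sab_iterate
    ((FinModel.sat_bigAnd _ _ _).mp hG.1 _ (List.mem_map.mpr ⟨d.toList, ?_, rfl⟩))
  rw [← Finset.length_toList d]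
  exact mem_distinctSeqs d.nodup_toList fun e he => by simpa using hd (by simpa using he)

/-- A world with a successor carries at most one fresh letter: deleting all edges out of `x`
isolates every world labelled `x`, hence isolates all its labels. -/
theorem FinModel.Sat.label_unique {M : FinModel α P} {N : FinModel β (P ⊕ α)} {w v : β}
    (h : N.Sat w (GF M)) (hv : (w, v) ∈ N.rel) {x x' : α}
    (hx : w ∈ N.val (.inr x)) (hx' : w ∈ N.val (.inr x')) : x = x' := by
  by_contra hne
  obtain ⟨y, hy, -⟩ := (FinModel.Sat.of_EF h.1 hx).2.2 v hv
  obtain ⟨y', hy', -⟩ := (FinModel.Sat.of_EF h.1 hx').2.2 v hv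
  obtain ⟨d', hd'⟩ := h.exists_delEdges_EF (d := M.rel.filter fun e => e.1 = x)
    (Finset.filter_subset _ _) ⟨(x, y), by simp [hy]⟩
  have hval := N.delEdges_val d'
  obtain ⟨-, hforth, -⟩ := FinModel.Sat.of_EF hd' (x := x') (by rwa [hval])
  obtain ⟨-, -, hback⟩ := FinModel.Sat.of_EF hd' (x := x) (by rwa [hval])
  obtain ⟨u, hu, -⟩ := hforth y' ((M.mem_delEdges_rel _ _).mpr ⟨hy', by simp [Ne.symm hne]⟩)
  obtain ⟨z, hz, -⟩ := hback u hu
  obtain ⟨hzM, hzd⟩ := (M.mem_delEdges_rel _ _).mp hz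
  exact hzd (by simp [hzM])

end Labelling

/-- A path along `R` lifts along `Z` to a path whose edges all lie in the image of `R` under a map
`g` choosing a lift of each edge, if `Z` is injective above points with a successor. -/
theorem exists_lift_of_isChain {Z : α → β → Prop} {R : Set (β × β)} {S : Set (α × α)}
    {g : β × β → α × α}
    (hg : ∀ x a b, (a, b) ∈ R → Z x a → g (a, b) ∈ S ∧ Z (g (a, b)).1 a ∧ Z (g (a, b)).2 b)
    (huniq : ∀ x x' a b, (a, b) ∈ R → Z x a → Z x' a → x = x')
    (ts : List β) (t0 : β) (s0 : α) (hZ : Z s0 t0)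
    (hts : List.IsChain (fun a b => (a, b) ∈ R) (t0 :: ts)) :
    ∃ ss : List α, List.Forall₂ Z (s0 :: ss) (t0 :: ts) ∧
      List.IsChain (fun x y => (x, y) ∈ g '' R ∩ S) (s0 :: ss) := by
  induction ts generalizing t0 s0 with
  | nil => exact ⟨[], by simpa using hZ, by simp⟩
  | cons t1 ts ih =>
    rw [List.isChain_cons_cons] at hts
    obtain ⟨hS, h1, h2⟩ := hg _ _ _ hts.1 hZ
    obtain ⟨ss, hss, hch⟩ := ih t1 _ h2 hts.2
    refine ⟨_ :: ss, .cons hZ hss, List.isChain_cons_cons.mpr ⟨?_, hch⟩⟩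
    rw [huniq _ _ _ _ hts.1 hZ h1]
    exact ⟨⟨_, hts.1, rfl⟩, hS⟩

/-- Suppose `M` has `n` edges and `(N',t)` is an expansion of `(N,t)` in which
`G(M)` is globally true and `p_s` holds at `t`.  Then for any sequence
`(j1,…,jl)` of pairwise distinct edges of `N` with `l ≤ n`, any path
`t0 → ⋯ → tk` in `N` with those edges deleted, whose start `t0` is reachable
from `t` in `N`, is matched by a sequence `(d1,…,dl)` of pairwise distinct
edges of `M` and a path `s0 → ⋯ → sk` in `M` with those edges deleted, whose
start `s0` is reachable from `s` in `M`, agreeing pointwise on all original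
propositional letters. -/
theorem zag_paths_of_expansion [Fintype α] [DecidableEq α]
    [Fintype β] [DecidableEq β] [Fintype P]
    (M : FinModel α P) (s : α) (N : FinModel β P) (t : β) (f : α → Finset β)
    (hG : ∀ w : β, (N.expand f).Sat w (GF M))
    (hps : (N.expand f).Sat t (.atom (.inr s)))
    (j : List (β × β)) (hjnd : j.Nodup) (hjN : ∀ e ∈ j, e ∈ N.rel)
    (hjl : j.length ≤ M.rel.card)
    (t0 : β) (ts : List β)
    (hpath : (N.delEdges j).IsPath (t0 :: ts))
    (hreach : N.Reach t t0) :
    ∃ (d : List (α × α)) (s0 : α) (ss : List α),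
      d.Nodup ∧ (∀ e ∈ d, e ∈ M.rel) ∧ d.length = j.length ∧
      (M.delEdges d).IsPath (s0 :: ss) ∧ M.Reach s s0 ∧
      List.Forall₂ (fun a b => ∀ p : P, a ∈ M.val p ↔ b ∈ N.val p)
        (s0 :: ss) (t0 :: ts) := by
  have hE : ∀ w x, w ∈ f x → _ := fun w x hx => FinModel.Sat.of_EF (hG w).1 (x := x) hx
  obtain ⟨s0, hs0, hr⟩ : ∃ s0, t0 ∈ f s0 ∧ M.Reach s s0 := by
    clear hpath
    induction hreach with
    | refl => exact ⟨s, hps, .refl⟩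
    | tail _ hbc ih =>
      obtain ⟨x, hx, hr⟩ := ih
      obtain ⟨y, hy, hyc⟩ := (hE _ _ hx).2.2 _ hbc
      exact ⟨y, hyc, hr.tail hy⟩
  have hlift : ∀ e : β × β, ∃ e' : α × α, ∀ x, e ∈ N.rel → e.1 ∈ f x →
      e' ∈ M.rel ∧ e.1 ∈ f e'.1 ∧ e.2 ∈ f e'.2 := by
    intro e
    by_cases h : ∃ x, e ∈ N.rel ∧ e.1 ∈ f x
    · obtain ⟨x, he, hx⟩ := h
      obtain ⟨y, hy, hye⟩ := (hE _ _ hx).2.2 _ he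
      exact ⟨(x, y), fun _ _ _ => ⟨hy, hx, hye⟩⟩
    · exact ⟨(s, s), fun x he hx => (h ⟨x, he, hx⟩).elim⟩
  choose g hg using hlift
  have hsub : ∀ e, e ∈ (N.delEdges j).rel → e ∈ N.rel := fun e he =>
    ((N.mem_delEdges_rel j e).mp he).1
  obtain ⟨ss, hZ, hch⟩ := exists_lift_of_isChain (Z := fun x a => a ∈ f x)
    (R := (N.delEdges j).rel) (S := M.rel) (g := g)
    (fun x a b hab hx => hg (a, b) x (hsub _ hab) hx)
    (fun x x' a b hab hx hx' => (hG a).label_unique (hsub _ hab) hx hx') ts t0 s0 hs0 hpath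
  set used := (N.delEdges j).rel.image g ∩ M.rel with hused
  have hcard : used.card + j.length ≤ M.rel.card := by
    have hj : (N.delEdges j).rel = N.rel \ j.toFinset := by
      ext e
      simp [N.mem_delEdges_rel]
    have hrel : (N.delEdges j).rel.card + j.length = N.rel.card := by
      rw [hj, ← List.toFinset_card_of_nodup hjnd]
      exact Finset.card_sdiff_add_card_eq_card fun e he => hjN e (by simpa using he)
    have hle : used.card ≤ (N.delEdges j).rel.card :=
      (Finset.card_le_card Finset.inter_subset_left).trans Finset.card_image_le
    have hNM : N.rel.card ≤ M.rel.card := (hG t).card_rel_le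
    omega
  obtain ⟨d, hd, hdcard⟩ := Finset.exists_subset_card_eq (s := M.rel \ used) (n := j.length) (by
    have := Finset.card_sdiff_add_card_eq_card (s := used) (t := M.rel) Finset.inter_subset_right
    omega)
  refine ⟨d.toList, s0, ss, d.nodup_toList, fun e he => ?_, by simpa using hdcard, ?_, hr, ?_⟩
  · exact (Finset.mem_sdiff.mp (hd (by simpa using he))).1
  · refine List.IsChain.imp (fun x y hxy => ?_) hch
    refine (M.mem_delEdges_rel _ _).mpr ⟨hxy.2, fun hmem => ?_⟩
    refine (Finset.mem_sdiff.mp (hd (by simpa using hmem))).2 ?_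
    rw [hused, ← Finset.mem_coe]
    simpa using hxy
  · exact hZ.imp fun a b hab => (hE b a hab).1
end
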